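/- arXiv:math/0607439 — 2 statements merged into one kernel-verified Lean document; each statement's English description precedes it below -/
import Mathlib

section
/- Let d ≥ 1 be an integer and let P_1 be the set of probability measures π on [0,1]^d × {−1,1} whose marginal on [0,1]^d is Lebesgue measure λ_d and whose regression function η satisfies |2η(x) − 1| = 1 for λ_d-almost every x (equivalently, the Bayes risk of π is zero). Then for every n ≥ 1, inf over all classifiers f̂_n of sup over π ∈ P_1 of E_{π^⊗n}[R(f̂_n) − R(f*)] is at least 1/(8e). -/
open MeasureTheory Set
open scoped ENNReal

noncomputable section

/-- Points of `ℝ^d`. -/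
abbrev Pt (d : ℕ) : Type := Fin d → ℝ

/-- The unit cube `[0,1]^d`. -/
def unitCube (d : ℕ) : Set (Pt d) := Set.Icc 0 1

/-- Lebesgue measure `λ_d` on `[0,1]^d`. -/
def lamd (d : ℕ) : Measure (Pt d) := volume.restrict (unitCube d)

/-- The dyadic subinterval of `[0,1]` at level `j` with index `k`:
`[k 2^{-j}, (k+1) 2^{-j})` for `k < 2^j - 1` and `[1 - 2^{-j}, 1]` for `k = 2^j - 1`. -/
def dyadicI (j k : ℕ) : Set ℝ :=
  if k = 2 ^ j - 1 then Set.Icc (1 - ((2 : ℝ) ^ j)⁻¹) 1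
  else Set.Ico ((k : ℝ) / 2 ^ j) (((k : ℝ) + 1) / 2 ^ j)

/-- The dyadic cube `I_k^{(j)} ⊆ [0,1]^d` at level `j` with multi-index `k`. -/
def dyadicCube (d j : ℕ) (k : Fin d → ℕ) : Set (Pt d) :=
  {x | ∀ i, x i ∈ dyadicI j (k i)}

/-- `f` is represented by the (automatically countable) family `T` of pairwise disjoint
dyadic cubes whose union has full Lebesgue measure in `[0,1]^d`, with `f` constant
on each cube of the family. -/
def IsDyadicRep (d : ℕ) (f : Pt d → ℝ) (T : Set (ℕ × (Fin d → ℕ))) : Prop :=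
  (∀ p ∈ T, ∀ i, p.2 i < 2 ^ p.1) ∧
  (T.PairwiseDisjoint fun p => dyadicCube d p.1 p.2) ∧
  lamd d (unitCube d \ ⋃ p ∈ T, dyadicCube d p.1 p.2) = 0 ∧
  (∀ p ∈ T, ∀ x ∈ dyadicCube d p.1 p.2, ∀ y ∈ dyadicCube d p.1 p.2, f x = f y)

/-- The class `F^(d)` of measurable `{-1,1}`-valued functions admitting a dyadic
representation. -/
def memF (d : ℕ) (f : Pt d → ℝ) : Prop :=
  Measurable f ∧ (∀ x, f x = 1 ∨ f x = -1) ∧ ∃ T, IsDyadicRep d f T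

/-- The class `F_w^(d)`: a dyadic representation with at most `w j` cubes of side
`2^{-j}` for every level `j`. -/
def memFw (d : ℕ) (w : ℕ → ℝ) (f : Pt d → ℝ) : Prop :=
  Measurable f ∧ (∀ x, f x = 1 ∨ f x = -1) ∧
    ∃ T, IsDyadicRep d f T ∧
      ∀ j, ((T ∩ {p | p.1 = j}).encard : ℝ≥0∞) ≤ ENNReal.ofReal (w j)

/-- Marginal `P^X` of `π` on `[0,1]^d`. -/
def margX {d : ℕ} (π : Measure (Pt d × ℝ)) : Measure (Pt d) := π.map Prod.fst

/-- The labels of `π` lie in `{-1, 1}` almost surely. -/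
def Labels {d : ℕ} (π : Measure (Pt d × ℝ)) : Prop := π {p | p.2 = 1 ∨ p.2 = -1} = 1

/-- `η` is the regression function (conditional probability of `Y = 1`) of `π`. -/
def IsRegression {d : ℕ} (π : Measure (Pt d × ℝ)) (η : Pt d → ℝ) : Prop :=
  Measurable η ∧ (∀ x, η x ∈ Set.Icc (0 : ℝ) 1) ∧
    ∀ s : Set (Pt d), MeasurableSet s →
      π (s ×ˢ {(1 : ℝ)}) = ∫⁻ x in s, ENNReal.ofReal (η x) ∂(margX π)

/-- The Bayes rule `f*` associated with the regression function `η`. -/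
def bayes {d : ℕ} (η : Pt d → ℝ) (x : Pt d) : ℝ := if 1 / 2 ≤ η x then 1 else -1

/-- Misclassification risk `R(f) = π({(x,y) : f(x) ≠ y})`. -/
def risk {d : ℕ} (π : Measure (Pt d × ℝ)) (f : Pt d → ℝ) : ℝ :=
  (π {p | f p.1 ≠ p.2}).toReal

/-- Assumption (A1): `P^X` is absolutely continuous w.r.t. `λ_d` with density
between `a` and `A`. -/
def A1cond {d : ℕ} (π : Measure (Pt d × ℝ)) (a A : ℝ) : Prop :=
  ∀ s : Set (Pt d), MeasurableSet s →
    ENNReal.ofReal a * lamd d s ≤ margX π s ∧ margX π s ≤ ENNReal.ofReal A * lamd d s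

/-- Strong margin assumption (SMA) with margin `h`. -/
def SMAcond {d : ℕ} (π : Measure (Pt d × ℝ)) (η : Pt d → ℝ) (h : ℝ) : Prop :=
  margX π {x | h ≤ |2 * η x - 1|} = 1

/-- Number of indices `i` satisfying `P i`. -/
def cnt (n : ℕ) (P : Fin n → Prop) : ℕ := Nat.card {i // P i}

/-- Index of the level-`J` dyadic interval containing `t ∈ [0,1]`. -/
def dyadicIdx (J : ℕ) (t : ℝ) : ℕ := min ⌊t * 2 ^ J⌋₊ (2 ^ J - 1)

/-- The level-`J` dyadic cube containing `x ∈ [0,1]^d`. -/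
def cubeOf (d J : ℕ) (x : Pt d) : Set (Pt d) := dyadicCube d J fun i => dyadicIdx J (x i)

open Classical in
/-- The dyadic majority-vote classifier `f̂_n^{(J)}` built from the sample `s`. -/
def fhat (d J n : ℕ) (s : Fin n → Pt d × ℝ) (x : Pt d) : ℝ :=
  if (∃ i, (s i).1 ∈ cubeOf d J x) ∧
      cnt n (fun i => (s i).1 ∈ cubeOf d J x ∧ (s i).2 = -1) <
        cnt n (fun i => (s i).1 ∈ cubeOf d J x ∧ (s i).2 = 1)
  then 1 else -1

/-- The `n`-fold product measure `π^{⊗n}` governing the i.i.d. sample. -/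
def sampM {d : ℕ} (π : Measure (Pt d × ℝ)) [SigmaFinite π] (n : ℕ) :
    Measure (Fin n → Pt d × ℝ) := Measure.pi fun _ => π

/-- Expected excess risk `E_{π^{⊗n}}[R(f̂_n) - R(f*)]` of the classifier `F`. -/
def excessExp {d : ℕ} (π : Measure (Pt d × ℝ)) [SigmaFinite π] (η : Pt d → ℝ) (n : ℕ)
    (F : (Fin n → Pt d × ℝ) → Pt d → ℝ) : ℝ :=
  ∫ s, risk π (F s) ∂(sampM π n) - risk π (bayes η)

/-- The class `P_{w,h,a,A}` of probability measures (together with their regression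
functions) satisfying (A1), (SMA), and whose Bayes rule belongs to `F_w^(d)`. -/
def Pclass (d : ℕ) (w : ℕ → ℝ) (h a A : ℝ) :
    Set (ProbabilityMeasure (Pt d × ℝ) × (Pt d → ℝ)) :=
  {p | Labels (p.1 : Measure (Pt d × ℝ)) ∧ IsRegression (p.1 : Measure (Pt d × ℝ)) p.2 ∧
       A1cond (p.1 : Measure (Pt d × ℝ)) a A ∧ SMAcond (p.1 : Measure (Pt d × ℝ)) p.2 h ∧
       memFw d w (bayes p.2)}

end

instance isProbabilityMeasure_lamd (d : ℕ) : IsProbabilityMeasure (lamd d) := by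
  constructor
  simp [lamd, unitCube, Real.volume_Icc_pi]

/-- The cube can be cut into `N` measurable slabs of measure at most `1 / N` each. -/
lemma exists_slabs (d : ℕ) (hd : 1 ≤ d) (N : ℕ) (hN : 1 ≤ N) :
    ∃ c : Pt d → Fin N, Measurable c ∧
      ∀ k, lamd d (c ⁻¹' {k}) ≤ ENNReal.ofReal (1 / N) := by
  have hN0 : (0 : ℝ) < N := by exact_mod_cast hN
  let i₀ : Fin d := ⟨0, hd⟩
  have hm : Measurable fun t : ℕ => (⟨min t (N - 1), by omega⟩ : Fin N) :=
    measurable_of_countable _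
  refine ⟨fun x => ⟨min ⌊(N : ℝ) * x i₀⌋₊ (N - 1), by omega⟩,
    hm.comp (Nat.measurable_floor.comp (by fun_prop)), fun k => ?_⟩
  rw [lamd, Measure.restrict_apply' (by exact measurableSet_Icc)]
  have hsub : ((fun x : Pt d => (⟨min ⌊(N : ℝ) * x i₀⌋₊ (N - 1), by omega⟩ : Fin N)) ⁻¹' {k}) ∩
      unitCube d ⊆ Set.Icc (Function.update 0 i₀ ((k : ℝ) / N))
        (Function.update 1 i₀ (((k : ℝ) + 1) / N)) := by
    rintro x ⟨hx, hx0, hx1⟩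
    have hk : min ⌊(N : ℝ) * x i₀⌋₊ (N - 1) = k := by
      simpa [Fin.ext_iff] using hx
    have h0 : 0 ≤ x i₀ := hx0 i₀
    have h1 : x i₀ ≤ 1 := hx1 i₀
    have hfl : (⌊(N : ℝ) * x i₀⌋₊ : ℝ) ≤ N * x i₀ := Nat.floor_le (by positivity)
    have hfu : (N : ℝ) * x i₀ < ⌊(N : ℝ) * x i₀⌋₊ + 1 := Nat.lt_floor_add_one _
    constructor
    · rw [update_le_iff]
      refine ⟨?_, fun j _ => hx0 j⟩
      have : (k : ℝ) ≤ ⌊(N : ℝ) * x i₀⌋₊ := by exact_mod_cast (by omega)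
      rw [div_le_iff₀ hN0]
      linarith
    · rw [le_update_iff]
      refine ⟨?_, fun j _ => hx1 j⟩
      rw [le_div_iff₀ hN0]
      rcases le_total ⌊(N : ℝ) * x i₀⌋₊ (N - 1) with h | h
      · have : (⌊(N : ℝ) * x i₀⌋₊ : ℝ) = k := by exact_mod_cast (by omega)
        linarith
      · have : (k : ℝ) + 1 = N := by exact_mod_cast (by omega)
        nlinarith
  refine (measure_mono hsub).trans ?_
  rw [Real.volume_Icc_pi, Finset.prod_eq_single i₀]
  · apply le_of_eq
    congr 1
    simp
    ring
  · intro j _ hj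
    simp [hj]
  · simp

/-- The label `1` on `S` and `-1` off `S`. -/
noncomputable def signOf {d : ℕ} (S : Set (Pt d)) [DecidablePred (· ∈ S)] (x : Pt d) : ℝ :=
  if x ∈ S then 1 else -1

section

variable {d : ℕ} {S : Set (Pt d)} [DecidablePred (· ∈ S)]

lemma measurable_signOf (hS : MeasurableSet S) : Measurable (signOf S) :=
  Measurable.ite hS measurable_const measurable_const

lemma measurable_graph_signOf (hS : MeasurableSet S) :
    Measurable fun x : Pt d => (x, signOf S x) :=
  measurable_id.prodMk (measurable_signOf hS)

/-- The law of `(X, signOf S X)` with `X` uniform on the cube. -/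
noncomputable def noiseless (S : Set (Pt d)) [DecidablePred (· ∈ S)] : Measure (Pt d × ℝ) :=
  (lamd d).map fun x => (x, signOf S x)

/-- The regression function of `noiseless S`. -/
noncomputable def noiselessReg (S : Set (Pt d)) [DecidablePred (· ∈ S)] (x : Pt d) : ℝ :=
  if x ∈ S then 1 else 0

lemma isProbabilityMeasure_noiseless (hS : MeasurableSet S) :
    IsProbabilityMeasure (noiseless S) :=
  Measure.isProbabilityMeasure_map (measurable_graph_signOf hS).aemeasurable

lemma margX_noiseless (hS : MeasurableSet S) : margX (noiseless S) = lamd d := by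
  rw [margX, noiseless, Measure.map_map measurable_fst (measurable_graph_signOf hS)]
  exact Measure.map_id

lemma labels_noiseless (hS : MeasurableSet S) : Labels (noiseless S) := by
  have hm : MeasurableSet {p : Pt d × ℝ | p.2 = 1 ∨ p.2 = -1} :=
    (measurableSet_eq_fun measurable_snd measurable_const).union
      (measurableSet_eq_fun measurable_snd measurable_const)
  rw [Labels, noiseless, Measure.map_apply (measurable_graph_signOf hS) hm]
  convert measure_univ (μ := lamd d)
  ext x
  by_cases h : x ∈ S <;> simp [signOf, h]

lemma isRegression_noiseless (hS : MeasurableSet S) :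
    IsRegression (noiseless S) (noiselessReg S) := by
  refine ⟨Measurable.ite hS measurable_const measurable_const, fun x => ?_, fun s hs => ?_⟩
  · by_cases h : x ∈ S <;> simp [noiselessReg, h]
  · rw [margX_noiseless hS, noiseless, Measure.map_apply (measurable_graph_signOf hS)
      (hs.prod (measurableSet_singleton _))]
    have h1 : (fun x => ENNReal.ofReal (noiselessReg S x)) = S.indicator 1 := by
      ext x
      by_cases h : x ∈ S <;> simp [noiselessReg, h]
    rw [h1, lintegral_indicator_one hS, Measure.restrict_apply hS]
    congr 1
    ext x
    by_cases h : x ∈ S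
    · simp [signOf, h]
    · simp only [signOf, h, mem_preimage, mem_prod, mem_singleton_iff, mem_inter_iff, if_false]
      norm_num

lemma bayes_noiselessReg : bayes (noiselessReg S) = signOf S := by
  ext x
  by_cases h : x ∈ S
  · norm_num [bayes, noiselessReg, signOf, h]
  · norm_num [bayes, noiselessReg, signOf, h]

lemma risk_noiseless (hS : MeasurableSet S) {f : Pt d → ℝ} (hf : Measurable f) :
    risk (noiseless S) f = (lamd d).real {x | f x ≠ signOf S x} := by
  have hm : MeasurableSet {p : Pt d × ℝ | f p.1 ≠ p.2} :=
    (measurableSet_eq_fun (hf.comp measurable_fst) measurable_snd).compl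
  rw [risk, noiseless, Measure.map_apply (measurable_graph_signOf hS) hm]
  rfl

lemma risk_nonneg (π : Measure (Pt d × ℝ)) (f : Pt d → ℝ) : 0 ≤ risk π f :=
  ENNReal.toReal_nonneg

lemma risk_le_one (π : Measure (Pt d × ℝ)) [IsProbabilityMeasure π] (f : Pt d → ℝ) :
    risk π f ≤ 1 := measureReal_le_one

lemma measurable_risk (π : Measure (Pt d × ℝ)) [IsProbabilityMeasure π] {n : ℕ}
    {F : (Fin n → Pt d × ℝ) → Pt d → ℝ} (hFm : Measurable (Function.uncurry F)) :
    Measurable fun s => risk π (F s) := by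
  have hm : MeasurableSet {q : (Fin n → Pt d × ℝ) × (Pt d × ℝ) | F q.1 q.2.1 ≠ q.2.2} :=
    (measurableSet_eq_fun (hFm.comp (measurable_fst.prodMk measurable_snd.fst))
      measurable_snd.snd).compl
  exact (measurable_measure_prodMk_left hm).ennreal_toReal

lemma excessExp_le_one (π : Measure (Pt d × ℝ)) [IsProbabilityMeasure π] (η : Pt d → ℝ) (n : ℕ)
    (F : (Fin n → Pt d × ℝ) → Pt d → ℝ) : excessExp π η n F ≤ 1 := by
  have : IsProbabilityMeasure (sampM π n) := by unfold sampM; infer_instance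
  have h := norm_integral_le_of_norm_le_const (μ := sampM π n) (f := fun s => risk π (F s))
    (C := 1) (.of_forall fun s => by
      rw [Real.norm_of_nonneg (risk_nonneg _ _)]
      exact risk_le_one _ _)
  have h' := le_of_abs_le h
  simp only [probReal_univ, mul_one] at h'
  have := risk_nonneg π (bayes η)
  unfold excessExp
  linarith

lemma excessExp_noiseless (hS : MeasurableSet S) [IsProbabilityMeasure (noiseless S)] {n : ℕ}
    {F : (Fin n → Pt d × ℝ) → Pt d → ℝ} (hFm : Measurable (Function.uncurry F)) :
    excessExp (noiseless S) (noiselessReg S) n F =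
      ∫ x, (lamd d).real {y | F (fun i => (x i, signOf S (x i))) y ≠ signOf S y}
        ∂(Measure.pi fun _ : Fin n => lamd d) := by
  have hmap : sampM (noiseless S) n = (Measure.pi fun _ : Fin n => lamd d).map
      fun x i => (x i, signOf S (x i)) :=
    (Measure.pi_map_pi (μ := fun _ : Fin n => lamd d)
      (fun _ => (measurable_graph_signOf hS).aemeasurable)).symm
  have hmeas : Measurable fun (x : Fin n → Pt d) i => (x i, signOf S (x i)) :=
    measurable_pi_lambda _ fun i => (measurable_graph_signOf hS).comp (measurable_pi_apply i)
  rw [excessExp, bayes_noiselessReg, risk_noiseless hS (measurable_signOf hS), hmap,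
    integral_map hmeas.aemeasurable (measurable_risk _ hFm).aestronglyMeasurable]
  simp only [ne_eq, not_true_eq_false, ofPred_false, measureReal_empty, sub_zero]
  congr 1
  ext x
  exact risk_noiseless hS (hFm.comp (measurable_const.prodMk measurable_id))

end

/-- A predicate on sign vectors negated by flipping the `k`-th sign holds for half of them. -/
lemma two_mul_card_filter_of_flip {N : ℕ} (k : Fin N) (P : (Fin N → Bool) → Prop)
    [DecidablePred P] (hP : ∀ σ, P (Function.update σ k (!σ k)) ↔ ¬ P σ) :
    2 * (Finset.univ.filter P).card = 2 ^ N := by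
  have hcard : (Finset.univ.filter P).card = (Finset.univ.filter fun σ => ¬ P σ).card := by
    refine Finset.card_bij' (fun σ _ => Function.update σ k (!σ k))
      (fun σ _ => Function.update σ k (!σ k)) ?_ ?_ ?_ ?_ <;> simp [hP]
  have h := Finset.card_filter_add_card_filter_not (s := (Finset.univ : Finset (Fin N → Bool))) P
  rw [← hcard] at h
  rw [two_mul, h]
  simp

/-- For a fixed design `x`, the risks averaged over all labellings of the cells are bounded below
by half of the measure of the cells not visited by `x`. -/
lemma sum_error_ge {d n N : ℕ} (hN : 1 ≤ N) {c : Pt d → Fin N} (hc : Measurable c)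
    (hcell : ∀ k, lamd d (c ⁻¹' {k}) ≤ ENNReal.ofReal (1 / N))
    {F : (Fin n → Pt d × ℝ) → Pt d → ℝ}
    (hFm : Measurable (Function.uncurry F)) (hF : ∀ s x, F s x = 1 ∨ F s x = -1)
    (x : Fin n → Pt d) :
    2 ^ N / 2 * (1 - (n : ℝ) / N) ≤ ∑ σ : Fin N → Bool, (lamd d).real
      {y | F (fun i => (x i, signOf {z | σ (c z) = true} (x i))) y ≠
        signOf {z | σ (c z) = true} y} := by
  classical
  set B : (Fin N → Bool) → Set (Pt d) := fun σ =>
    {y | F (fun i => (x i, signOf {z | σ (c z) = true} (x i))) y ≠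
      signOf {z | σ (c z) = true} y} with hB
  set V : Set (Pt d) := ⋃ i, c ⁻¹' {c (x i)}
  have hSm (σ : Fin N → Bool) : MeasurableSet {z | σ (c z) = true} :=
    hc (measurableSet_eq_fun (measurable_of_countable σ) measurable_const)
  have hBm (σ) : MeasurableSet (B σ) :=
    (measurableSet_eq_fun (hFm.comp (measurable_const.prodMk measurable_id))
      (measurable_signOf (hSm σ))).compl
  have hVm : MeasurableSet V := .iUnion fun i => hc (measurableSet_singleton _)
  have hVle : (lamd d).real V ≤ n / N := by
    refine (measureReal_iUnion_fintype_le _).trans ?_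
    have : ∀ i ∈ (Finset.univ : Finset (Fin n)),
        (lamd d).real (c ⁻¹' {c (x i)}) ≤ 1 / N := fun i _ =>
      ENNReal.toReal_le_of_le_ofReal (by positivity) (hcell _)
    refine (Finset.sum_le_sum this).trans (le_of_eq ?_)
    simp [div_eq_mul_inv]
  have hpt (y : Pt d) : Vᶜ.indicator (fun _ => (2 : ℝ) ^ N / 2) y ≤
      ∑ σ, (B σ).indicator (fun _ => (1 : ℝ)) y := by
    by_cases hy : y ∈ V
    · rw [indicator_of_notMem (by simpa using hy)]
      exact Finset.sum_nonneg fun σ _ => indicator_nonneg (fun _ _ => zero_le_one) _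
    · rw [indicator_of_mem (by simpa using hy)]
      have hne (i) : c (x i) ≠ c y := fun h => hy (mem_iUnion.2 ⟨i, h.symm⟩)
      have key := two_mul_card_filter_of_flip (c y) (fun σ => y ∈ B σ) (fun σ => by
        simp only [hB, mem_ofPred_eq, signOf, Function.update_of_ne (hne _), Function.update_self]
        rcases hF (fun i => (x i, if σ (c (x i)) = true then 1 else -1)) y with h | h <;>
          rw [h] <;> by_cases hσ : σ (c y) = true <;> norm_num [hσ])
      have : ∑ σ, (B σ).indicator (fun _ => (1 : ℝ)) y =
          ((Finset.univ.filter fun σ => y ∈ B σ).card : ℝ) := by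
        rw [Finset.card_filter]
        push_cast
        exact Finset.sum_congr rfl fun σ _ => by by_cases h : y ∈ B σ <;> simp [h]
      rw [this]
      have key' : (2 : ℝ) * ((Finset.univ.filter fun σ => y ∈ B σ).card : ℝ) = 2 ^ N := by
        exact_mod_cast key
      linarith
  have hint (σ) : Integrable ((B σ).indicator fun _ => (1 : ℝ)) (lamd d) :=
    (integrable_const _).indicator (hBm σ)
  have h := integral_mono ((integrable_const _).indicator hVm.compl)
    (integrable_finsetSum Finset.univ fun σ _ => hint σ) hpt
  rw [integral_finsetSum _ fun σ _ => hint σ, integral_indicator_const _ hVm.compl,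
    probReal_compl_eq_one_sub hVm, smul_eq_mul] at h
  simp only [integral_indicator_const _ (hBm _), smul_eq_mul, mul_one] at h
  refine le_trans ?_ h
  rw [mul_comm]
  gcongr

/-- Over the class of distributions with marginal `λ_d` and zero
Bayes risk, no classifier can have worst-case expected excess risk smaller than
`1/(8e)`. -/
theorem no_rate_zero_error (d : ℕ) (hd : 1 ≤ d) (n : ℕ) (hn : 1 ≤ n)
    (F : (Fin n → Pt d × ℝ) → Pt d → ℝ)
    (hFm : Measurable (Function.uncurry F)) (hF : ∀ s x, F s x = 1 ∨ F s x = -1) :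
    1 / (8 * Real.exp 1) ≤
      ⨆ p : ↥{q : ProbabilityMeasure (Pt d × ℝ) × (Pt d → ℝ) |
          Labels (q.1 : Measure (Pt d × ℝ)) ∧ IsRegression (q.1 : Measure (Pt d × ℝ)) q.2 ∧
          margX (q.1 : Measure (Pt d × ℝ)) = lamd d ∧
          (∀ᵐ x ∂(lamd d), |2 * q.2 x - 1| = 1)},
        excessExp (p.1.1 : Measure (Pt d × ℝ)) p.1.2 n F := by
  set M := ⨆ p : ↥{q : ProbabilityMeasure (Pt d × ℝ) × (Pt d → ℝ) |
          Labels (q.1 : Measure (Pt d × ℝ)) ∧ IsRegression (q.1 : Measure (Pt d × ℝ)) q.2 ∧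
          margX (q.1 : Measure (Pt d × ℝ)) = lamd d ∧
          (∀ᵐ x ∂(lamd d), |2 * q.2 x - 1| = 1)},
        excessExp (p.1.1 : Measure (Pt d × ℝ)) p.1.2 n F
  have hN : 1 ≤ 2 * n := by omega
  obtain ⟨c, hc, hcell⟩ := exists_slabs d hd (2 * n) hN
  have hSm (σ : Fin (2 * n) → Bool) : MeasurableSet {z | σ (c z) = true} :=
    hc (measurableSet_eq_fun (measurable_of_countable σ) measurable_const)
  let err (σ : Fin (2 * n) → Bool) (x : Fin n → Pt d) : ℝ := (lamd d).real
    {y | F (fun i => (x i, signOf {z | σ (c z) = true} (x i))) y ≠ signOf {z | σ (c z) = true} y}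
  have hle (σ) : ∫ x, err σ x ∂(Measure.pi fun _ : Fin n => lamd d) ≤ M := by
    have hp := isProbabilityMeasure_noiseless (hSm σ)
    rw [← excessExp_noiseless (hSm σ) hFm]
    refine le_ciSup (f := fun p : ↥{q : ProbabilityMeasure (Pt d × ℝ) × (Pt d → ℝ) |
          Labels (q.1 : Measure (Pt d × ℝ)) ∧ IsRegression (q.1 : Measure (Pt d × ℝ)) q.2 ∧
          margX (q.1 : Measure (Pt d × ℝ)) = lamd d ∧
          (∀ᵐ x ∂(lamd d), |2 * q.2 x - 1| = 1)} =>
        excessExp (p.1.1 : Measure (Pt d × ℝ)) p.1.2 n F)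
      ⟨1, by rintro _ ⟨p, rfl⟩; exact excessExp_le_one _ _ _ _⟩
      ⟨(⟨noiseless {z | σ (c z) = true}, hp⟩, noiselessReg {z | σ (c z) = true}),
        labels_noiseless (hSm σ), isRegression_noiseless (hSm σ), margX_noiseless (hSm σ),
        .of_forall fun x => ?_⟩
    by_cases h : σ (c x) = true <;> norm_num [noiselessReg, h]
  have hint (σ) : Integrable (err σ) (Measure.pi fun _ : Fin n => lamd d) := by
    have hp := isProbabilityMeasure_noiseless (hSm σ)
    have hmeas : Measurable fun (x : Fin n → Pt d) i =>
        (x i, signOf {z | σ (c z) = true} (x i)) :=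
      measurable_pi_lambda _ fun i =>
        (measurable_graph_signOf (hSm σ)).comp (measurable_pi_apply i)
    have herr : err σ = fun x => risk (noiseless {z | σ (c z) = true})
        (F fun i => (x i, signOf {z | σ (c z) = true} (x i))) := by
      ext x
      exact (risk_noiseless (hSm σ) (hFm.comp (measurable_const.prodMk measurable_id))).symm
    have hm : Measurable (err σ) := herr ▸ (measurable_risk _ hFm).comp hmeas
    refine Integrable.of_bound hm.aestronglyMeasurable 1 (.of_forall fun x => ?_)
    rw [Real.norm_of_nonneg measureReal_nonneg]
    exact measureReal_le_one
  have hlow : (2 : ℝ) ^ (2 * n) / 2 * (1 - (n : ℝ) / (2 * n : ℕ)) ≤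
      ∑ σ, ∫ x, err σ x ∂(Measure.pi fun _ : Fin n => lamd d) := by
    rw [← integral_finsetSum _ fun σ _ => hint σ]
    have h := integral_mono (μ := Measure.pi fun _ : Fin n => lamd d) (integrable_const _)
      (integrable_finsetSum Finset.univ fun σ _ => hint σ)
      (sum_error_ge hN hc hcell hFm hF)
    simpa using h
  have hup := Finset.sum_le_sum fun σ (_ : σ ∈ Finset.univ) => hle σ
  simp only [Finset.sum_const, Finset.card_univ, Fintype.card_fun, Fintype.card_bool,
    Fintype.card_fin, nsmul_eq_mul] at hup
  push_cast at hup hlow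
  have hn0 : (0 : ℝ) < n := by exact_mod_cast hn
  have hhalf : (n : ℝ) / (2 * n) = 1 / 2 := by field_simp
  rw [hhalf] at hlow
  have hpow : (0 : ℝ) < 2 ^ (2 * n) := by positivity
  have hquarter : 1 / 4 ≤ M := by
    refine le_of_mul_le_mul_left ?_ hpow
    linarith
  refine le_trans ?_ hquarter
  have he : 1 ≤ Real.exp 1 := Real.one_le_exp zero_le_one
  exact one_div_le_one_div_of_le (by norm_num) (by linarith)
end

section
/- (Rate for the exponential class, upper bound) Let d ≥ 1 be an integer, 0 < α < 1, 0 < h ≤ 1, 0 < a ≤ 1 ≤ A < ∞. Let N(α) = ⌈log(2^d − 1)/(d·α·log 2)⌉ and let w_α(j) = 2^{dj} for j ≤ N(α) and w_α(j) = 2^{dαj} for j > N(α); let P_α^(d) = P_{w_α,h,a,A}. Then there exist a constant C > 0 depending only on α, d, h, a, A and a sequence of frequency ranks (J_n) such that for every n ≥ 3, sup over π ∈ P_α^(d) of E_{π^⊗n}[R(f̂_n^{(J_n)}) − R(f*)] ≤ C · ((log n)/n)^{1−α}, where f̂_n^{(J_n)} is the dyadic majority-vote classifier built from an i.i.d. sample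 of size n from π. -/
open MeasureTheory Set
open scoped ENNReal

/-- The dyadic index is the only candidate for the dyadic interval containing a point. -/
theorem mem_dyadicI_iff {j k : ℕ} (hk : k < 2 ^ j) (t : ℝ) :
    t ∈ dyadicI j k ↔ t ∈ Icc (0 : ℝ) 1 ∧ dyadicIdx j t = k := by
  have hp : (0 : ℝ) < 2 ^ j := by positivity
  have h1 : 1 ≤ 2 ^ j := Nat.one_le_two_pow
  have hc : ((2 ^ j - 1 : ℕ) : ℝ) = 2 ^ j - 1 := by push_cast [Nat.cast_sub h1]; ring
  unfold dyadicI dyadicIdx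
  split_ifs with h
  · subst h
    have e : (1 : ℝ) - (2 ^ j)⁻¹ = (2 ^ j - 1) / 2 ^ j := by field_simp
    rw [e, mem_Icc, mem_Icc, div_le_iff₀ hp, min_eq_right_iff]
    constructor
    · rintro ⟨h2, h3⟩
      have h1' : (1 : ℝ) ≤ 2 ^ j := by exact_mod_cast h1
      have h4 : 0 ≤ t := by
        by_contra hneg
        push Not at hneg
        nlinarith
      exact ⟨⟨h4, h3⟩, Nat.le_floor (by rw [hc]; exact h2)⟩
    · rintro ⟨⟨h2, h3⟩, h4⟩
      refine ⟨?_, h3⟩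
      rw [← hc]
      exact (Nat.le_floor_iff (by positivity)).1 h4
  · have hk' : k < 2 ^ j - 1 := by omega
    have hk2 : ((k : ℝ) + 1) ≤ 2 ^ j := by exact_mod_cast hk
    rw [mem_Ico, div_le_iff₀ hp, lt_div_iff₀ hp, mem_Icc]
    constructor
    · rintro ⟨h2, h3⟩
      have h4 : 0 ≤ t := by
        by_contra hneg
        push Not at hneg
        have : (0 : ℝ) ≤ k := by positivity
        nlinarith
      refine ⟨⟨h4, by nlinarith⟩, ?_⟩
      have : ⌊t * 2 ^ j⌋₊ = k := (Nat.floor_eq_iff (by positivity)).2 ⟨h2, h3⟩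
      omega
    · rintro ⟨⟨h2, h3⟩, h4⟩
      have : ⌊t * 2 ^ j⌋₊ = k := by omega
      exact (Nat.floor_eq_iff (by positivity)).1 this

theorem mem_dyadicCube_iff {d j : ℕ} {k : Fin d → ℕ} (hk : ∀ i, k i < 2 ^ j) (x : Pt d) :
    x ∈ dyadicCube d j k ↔ x ∈ unitCube d ∧ ∀ i, dyadicIdx j (x i) = k i := by
  simp only [dyadicCube, mem_ofPred_eq, mem_dyadicI_iff (hk _), unitCube, mem_Icc, Pi.le_def,
    Pi.zero_apply, Pi.one_apply]
  constructor
  · exact fun h => ⟨⟨fun i => (h i).1.1, fun i => (h i).1.2⟩, fun i => (h i).2⟩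
  · exact fun h i => ⟨⟨h.1.1 i, h.1.2 i⟩, h.2 i⟩

theorem dyadicIdx_lt (j : ℕ) (t : ℝ) : dyadicIdx j t < 2 ^ j := by
  have h1 : 1 ≤ 2 ^ j := Nat.one_le_two_pow
  unfold dyadicIdx
  omega

theorem dyadicIdx_eq_div {j J : ℕ} (hj : j ≤ J) (t : ℝ) :
    dyadicIdx j t = dyadicIdx J t / 2 ^ (J - j) := by
  obtain ⟨m, rfl⟩ := Nat.exists_eq_add_of_le hj
  have hm : Monotone fun a : ℕ => a / 2 ^ m := fun a b hab => Nat.div_le_div_right hab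
  have e1 : ⌊t * 2 ^ (j + m)⌋₊ / 2 ^ m = ⌊t * 2 ^ j⌋₊ := by
    have := Nat.floor_div_natCast (t * 2 ^ (j + m)) (2 ^ m)
    rw [← this]
    congr 1
    push_cast
    rw [pow_add]
    field_simp
  have e2 : (2 ^ (j + m) - 1) / 2 ^ m = 2 ^ j - 1 := by
    have h1 : 1 ≤ 2 ^ j := Nat.one_le_two_pow
    have h2 : 1 ≤ 2 ^ m := Nat.one_le_two_pow
    rw [Nat.div_eq_iff (by positivity), pow_add, Nat.sub_mul, one_mul]
    have : 2 ^ m ≤ 2 ^ j * 2 ^ m := Nat.le_mul_of_pos_left _ (by positivity)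
    omega
  unfold dyadicIdx
  rw [Nat.add_sub_cancel_left]
  rw [show min ⌊t * 2 ^ (j + m)⌋₊ (2 ^ (j + m) - 1) / 2 ^ m =
    min (⌊t * 2 ^ (j + m)⌋₊ / 2 ^ m) ((2 ^ (j + m) - 1) / 2 ^ m) from hm.map_min, e1, e2]

theorem dyadicCube_subset_of_mem {d j J : ℕ} (hj : j ≤ J) {k l : Fin d → ℕ}
    (hk : ∀ i, k i < 2 ^ j) (hl : ∀ i, l i < 2 ^ J) {x : Pt d}
    (hx : x ∈ dyadicCube d j k) (hx' : x ∈ dyadicCube d J l) :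
    dyadicCube d J l ⊆ dyadicCube d j k := by
  intro y hy
  rw [mem_dyadicCube_iff hk] at hx ⊢
  rw [mem_dyadicCube_iff hl] at hx' hy
  refine ⟨hy.1, fun i => ?_⟩
  rw [← hx.2 i, dyadicIdx_eq_div hj, dyadicIdx_eq_div hj, hy.2 i, hx'.2 i]

theorem mem_cubeOf {d J : ℕ} {x : Pt d} (hx : x ∈ unitCube d) : x ∈ cubeOf d J x :=
  (mem_dyadicCube_iff (fun _ => dyadicIdx_lt _ _) x).2 ⟨hx, fun _ => rfl⟩

theorem cubeOf_eq {d J : ℕ} {k : Fin d → ℕ} (hk : ∀ i, k i < 2 ^ J) {x : Pt d}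
    (hx : x ∈ dyadicCube d J k) : cubeOf d J x = dyadicCube d J k := by
  rw [mem_dyadicCube_iff hk] at hx
  unfold cubeOf
  congr 1
  exact funext hx.2

theorem dyadicCube_eq_pi (d j : ℕ) (k : Fin d → ℕ) :
    dyadicCube d j k = Set.pi univ fun i => dyadicI j (k i) := by
  ext x; simp [dyadicCube]

theorem measurableSet_dyadicCube (d j : ℕ) (k : Fin d → ℕ) :
    MeasurableSet (dyadicCube d j k) := by
  rw [dyadicCube_eq_pi]
  refine MeasurableSet.univ_pi fun i => ?_
  unfold dyadicI
  split_ifs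
  · exact measurableSet_Icc
  · exact measurableSet_Ico

theorem volume_dyadicI (j k : ℕ) : volume (dyadicI j k) = ENNReal.ofReal ((2 ^ j)⁻¹) := by
  unfold dyadicI
  split_ifs
  · rw [Real.volume_Icc]; congr 1; ring
  · rw [Real.volume_Ico]; congr 1; ring

theorem volume_dyadicCube (d j : ℕ) (k : Fin d → ℕ) :
    volume (dyadicCube d j k) = ENNReal.ofReal ((2 ^ (d * j))⁻¹) := by
  rw [dyadicCube_eq_pi, volume_pi_pi]
  simp only [volume_dyadicI, Finset.prod_const, Finset.card_univ, Fintype.card_fin]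
  rw [← ENNReal.ofReal_pow (by positivity), inv_pow, ← pow_mul, mul_comm]

theorem dyadicCube_subset_unitCube {d j : ℕ} {k : Fin d → ℕ} (hk : ∀ i, k i < 2 ^ j) :
    dyadicCube d j k ⊆ unitCube d := fun x hx => ((mem_dyadicCube_iff hk x).1 hx).1

theorem lamd_dyadicCube {d j : ℕ} {k : Fin d → ℕ} (hk : ∀ i, k i < 2 ^ j) :
    lamd d (dyadicCube d j k) = ENNReal.ofReal ((2 ^ (d * j))⁻¹) := by
  rw [lamd, Measure.restrict_eq_self _ (dyadicCube_subset_unitCube hk), volume_dyadicCube]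

/-- The volume covered by the cubes of level greater than `J` of a family with geometrically
controlled numbers of cubes. -/
theorem lamd_iUnion_fine_le {d : ℕ} {T : Set (ℕ × (Fin d → ℕ))}
    (w : ℕ → ℝ) {K r : ℝ} (hK : 0 ≤ K) (hr0 : 0 ≤ r) (hr1 : r < 1)
    (hT : ∀ j, ((T ∩ {p | p.1 = j}).encard : ℝ≥0∞) ≤ ENNReal.ofReal (w j))
    (hw : ∀ j, w j * (2 ^ (d * j))⁻¹ ≤ K * r ^ j) (hw0 : ∀ j, 0 ≤ w j) (J : ℕ) :
    lamd d (⋃ p ∈ T ∩ {p | J < p.1}, dyadicCube d p.1 p.2) ≤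
      ENNReal.ofReal (K / (1 - r) * r ^ J) := by
  have hsub : (⋃ p ∈ T ∩ {p | J < p.1}, dyadicCube d p.1 p.2) ⊆
      ⋃ m : ℕ, ⋃ p ∈ T ∩ {p | p.1 = J + m}, dyadicCube d p.1 p.2 := by
    refine iUnion₂_subset fun p hp => ?_
    obtain ⟨m, hm⟩ := Nat.exists_eq_add_of_lt hp.2
    refine Subset.trans ?_ (subset_iUnion _ (m + 1))
    exact subset_biUnion_of_mem (u := fun p : ℕ × (Fin d → ℕ) => dyadicCube d p.1 p.2)
      (show p ∈ T ∩ {p | p.1 = J + (m + 1)} from ⟨hp.1, by simpa [add_assoc] using hm⟩)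
  have hlev : ∀ m : ℕ, lamd d (⋃ p ∈ T ∩ {p | p.1 = J + m}, dyadicCube d p.1 p.2) ≤
      ENNReal.ofReal (K * r ^ J * r ^ m) := by
    intro m
    refine (measure_biUnion_le _ (to_countable _) _).trans ?_
    calc ∑' p : ↥(T ∩ {p | p.1 = J + m}), lamd d (dyadicCube d p.1.1 p.1.2)
        ≤ ∑' _p : ↥(T ∩ {p | p.1 = J + m}), ENNReal.ofReal ((2 ^ (d * (J + m)))⁻¹) := by
          refine ENNReal.tsum_le_tsum fun p => ?_
          have hp : p.1.1 = J + m := p.2.2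
          exact (Measure.restrict_apply_le _ _).trans_eq (by rw [volume_dyadicCube, hp])
      _ = (T ∩ {p | p.1 = J + m}).encard * ENNReal.ofReal ((2 ^ (d * (J + m)))⁻¹) :=
          ENNReal.tsum_set_const ..
      _ ≤ ENNReal.ofReal (w (J + m)) * ENNReal.ofReal ((2 ^ (d * (J + m)))⁻¹) := by
          gcongr; exact hT _
      _ = ENNReal.ofReal (w (J + m) * (2 ^ (d * (J + m)))⁻¹) :=
          (ENNReal.ofReal_mul (hw0 _)).symm
      _ ≤ _ := by
          refine ENNReal.ofReal_le_ofReal ((hw _).trans_eq ?_)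
          rw [pow_add, mul_assoc]
  calc _ ≤ _ := measure_mono hsub
    _ ≤ _ := measure_iUnion_le _
    _ ≤ ∑' m : ℕ, ENNReal.ofReal (K * r ^ J * r ^ m) := ENNReal.tsum_le_tsum hlev
    _ = ENNReal.ofReal (∑' m : ℕ, K * r ^ J * r ^ m) :=
        (ENNReal.ofReal_tsum_of_nonneg (fun m => by positivity)
          ((summable_geometric_of_lt_one hr0 hr1).mul_left _)).symm
    _ = _ := by
        rw [tsum_mul_left, tsum_geometric_of_lt_one hr0 hr1]
        congr 1
        ring

section Regression

variable {d : ℕ} {π : Measure (Pt d × ℝ)}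

theorem margX_apply {s : Set (Pt d)} (hs : MeasurableSet s) :
    margX π s = π (s ×ˢ univ) := by
  rw [margX, Measure.map_apply measurable_fst hs, prod_univ]

theorem margX_real_apply {s : Set (Pt d)} (hs : MeasurableSet s) :
    (margX π).real s = π.real (s ×ˢ univ) := by
  rw [Measure.real, Measure.real, margX_apply hs]

theorem measureReal_label_one {η : Pt d → ℝ} (hη : IsRegression π η) {s : Set (Pt d)}
    (hs : MeasurableSet s) : π.real (s ×ˢ {(1 : ℝ)}) = ∫ x in s, η x ∂margX π := by
  rw [Measure.real, hη.2.2 s hs, integral_eq_lintegral_of_nonneg_ae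
    (Filter.Eventually.of_forall fun x => (hη.2.1 x).1) hη.1.aestronglyMeasurable]

variable [IsProbabilityMeasure π]

instance : IsProbabilityMeasure (margX π) := Measure.isProbabilityMeasure_map (by fun_prop)

theorem ae_margin {η : Pt d → ℝ} {h : ℝ} (hη : Measurable η) (hS : SMAcond π η h) :
    ∀ᵐ x ∂margX π, h ≤ |2 * η x - 1| :=
  (mem_ae_iff_prob_eq_one (measurableSet_le measurable_const (by fun_prop))).2 hS

theorem measureReal_label_add (hL : Labels π) {s : Set (Pt d)} (hs : MeasurableSet s) :
    π.real (s ×ˢ {(1 : ℝ)}) + π.real (s ×ˢ {(-1 : ℝ)}) = (margX π).real s := by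
  have hm1 : MeasurableSet {p : Pt d × ℝ | p.2 = 1 ∨ p.2 = -1} :=
    (measurable_snd (measurableSet_singleton 1)).union
      (measurable_snd (measurableSet_singleton (-1)))
  have hae : ∀ᵐ p ∂π, p.2 = 1 ∨ p.2 = -1 := (mem_ae_iff_prob_eq_one hm1).2 hL
  rw [margX_real_apply hs, ← measureReal_union ?_ (hs.prod (measurableSet_singleton _))]
  · refine measureReal_congr ?_
    filter_upwards [hae] with p hp
    refine propext ?_
    change p ∈ s ×ˢ {(1 : ℝ)} ∪ s ×ˢ {(-1 : ℝ)} ↔ p ∈ s ×ˢ (univ : Set ℝ)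
    simp only [mem_union, mem_prod, mem_singleton_iff, mem_univ, and_true]
    tauto
  · refine disjoint_left.2 ?_
    rintro p ⟨-, h1⟩ ⟨-, h2⟩
    rw [mem_singleton_iff] at h1 h2
    norm_num [h1] at h2

/-- On a set where the Bayes rule is constant, its label has conditional probability at least
`(1 + h) / 2`. -/
theorem le_measureReal_label {η : Pt d → ℝ} {h : ℝ} (hL : Labels π) (hη : IsRegression π η)
    (hS : SMAcond π η h) {s : Set (Pt d)} (hs : MeasurableSet s) {σ : ℝ}
    (hσ : σ = 1 ∨ σ = -1) (hb : ∀ x ∈ s, bayes η x = σ) :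
    (1 + h) / 2 * (margX π).real s ≤ π.real (s ×ˢ {σ}) := by
  have hint : IntegrableOn η s (margX π) := by
    refine (Integrable.of_bound hη.1.aestronglyMeasurable 1 ?_).integrableOn
    refine Filter.Eventually.of_forall fun x => ?_
    rw [Real.norm_eq_abs, abs_le]
    constructor <;> linarith [(hη.2.1 x).1, (hη.2.1 x).2]
  have hconst : ∀ c : ℝ, ∫ _ in s, c ∂margX π = c * (margX π).real s := fun c => by
    rw [setIntegral_const, smul_eq_mul, mul_comm]
  rcases hσ with rfl | rfl
  · rw [measureReal_label_one hη hs, ← hconst]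
    refine setIntegral_mono_on_ae integrableOn_const hint hs ?_
    filter_upwards [ae_margin hη.1 hS] with x hx hxs
    have h1 : 1 / 2 ≤ η x := by
      by_contra hcon
      have := hb x hxs
      norm_num [bayes, hcon] at this
    rw [abs_of_nonneg (by linarith)] at hx
    linarith
  · have h2 : π.real (s ×ˢ {(1 : ℝ)}) ≤ (1 - h) / 2 * (margX π).real s := by
      rw [measureReal_label_one hη hs, ← hconst]
      refine setIntegral_mono_on_ae hint integrableOn_const hs ?_
      filter_upwards [ae_margin hη.1 hS] with x hx hxs
      have h1 : η x < 1 / 2 := by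
        by_contra hcon
        have := hb x hxs
        norm_num [bayes, not_lt.1 hcon] at this
      rw [abs_of_neg (by linarith)] at hx
      linarith
    linarith [measureReal_label_add hL hs]

end Regression

section Voting

variable {d : ℕ}

open Classical in
/-- Exponential weight of an observation in the vote on the cube `s` with correct label `σ`. -/
noncomputable def voteWeight (s : Set (Pt d)) (σ u : ℝ) (p : Pt d × ℝ) : ℝ :=
  (if p.1 ∈ s ∧ p.2 = σ then u else 1) * (if p.1 ∈ s ∧ p.2 ≠ σ then u⁻¹ else 1)

theorem voteWeight_nonneg (s : Set (Pt d)) (σ : ℝ) {u : ℝ} (hu : 0 ≤ u) (p : Pt d × ℝ) :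
    0 ≤ voteWeight s σ u p := by
  unfold voteWeight
  positivity

theorem voteWeight_eq (s : Set (Pt d)) (σ u : ℝ) (p : Pt d × ℝ) :
    voteWeight s σ u p = 1 + (s ×ˢ univ).indicator (fun _ => u⁻¹ - 1) p +
      (s ×ˢ {σ}).indicator (fun _ => u - u⁻¹) p := by
  by_cases h1 : p.1 ∈ s <;> by_cases h2 : p.2 = σ <;>
    simp [voteWeight, indicator, h1, h2]

theorem cnt_mono {n : ℕ} {P Q : Fin n → Prop} (h : ∀ i, P i → Q i) : cnt n P ≤ cnt n Q :=
  Nat.card_le_card_of_injective (Subtype.map id h) (Subtype.map_injective h Function.injective_id)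

theorem cnt_eq_card {n : ℕ} (P : Fin n → Prop) [DecidablePred P] :
    cnt n P = (Finset.univ.filter P).card := by
  rw [cnt, Nat.card_eq_fintype_card, Fintype.card_subtype]

/-- A wrong vote forces the product of the weights to be at least one. -/
theorem one_le_prod_voteWeight {J n : ℕ} (t : Fin n → Pt d × ℝ) {x : Pt d} {σ u : ℝ}
    (hσ : σ = 1 ∨ σ = -1) (hu0 : 0 < u) (hu1 : u ≤ 1) (hx : fhat d J n t x ≠ σ) :
    1 ≤ ∏ i, voteWeight (cubeOf d J x) σ u (t i) := by
  classical
  have hle : cnt n (fun i => (t i).1 ∈ cubeOf d J x ∧ (t i).2 = σ) ≤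
      cnt n (fun i => (t i).1 ∈ cubeOf d J x ∧ (t i).2 ≠ σ) := by
    have hneg : ∀ i, (t i).1 ∈ cubeOf d J x ∧ (t i).2 = -1 →
        (t i).1 ∈ cubeOf d J x ∧ (t i).2 ≠ 1 := fun i hi => ⟨hi.1, by rw [hi.2]; norm_num⟩
    have hpos : ∀ i, (t i).1 ∈ cubeOf d J x ∧ (t i).2 = 1 →
        (t i).1 ∈ cubeOf d J x ∧ (t i).2 ≠ -1 := fun i hi => ⟨hi.1, by rw [hi.2]; norm_num⟩
    unfold fhat at hx
    split_ifs at hx with hv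
    · rcases hσ with rfl | rfl
      · exact absurd rfl hx
      · exact hv.2.le.trans (cnt_mono hpos)
    · rcases hσ with rfl | rfl
      · refine le_trans ?_ (cnt_mono hneg)
        by_contra hcon
        push Not at hcon
        refine hv ⟨?_, hcon⟩
        have : 0 < cnt n (fun i => (t i).1 ∈ cubeOf d J x ∧ (t i).2 = 1) := by omega
        obtain ⟨⟨i, hi⟩⟩ := (Nat.card_pos_iff.1 this).1
        exact ⟨i, hi.1⟩
      · exact absurd rfl hx
  rw [cnt_eq_card, cnt_eq_card] at hle
  simp only [voteWeight, Finset.prod_mul_distrib, Finset.prod_ite, Finset.prod_const, one_pow,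
    mul_one]
  rw [inv_pow, ← div_eq_mul_inv, one_le_div (by positivity)]
  exact pow_le_pow_of_le_one hu0.le hu1 hle

variable {π : Measure (Pt d × ℝ)} [IsProbabilityMeasure π]

theorem integrable_voteWeight {s : Set (Pt d)} (hs : MeasurableSet s) (σ u : ℝ) :
    Integrable (voteWeight s σ u) π := by
  rw [funext (voteWeight_eq s σ u)]
  exact ((integrable_const _).add ((integrable_const _).indicator (hs.prod .univ))).add
    ((integrable_const _).indicator (hs.prod (measurableSet_singleton _)))

theorem integral_voteWeight {s : Set (Pt d)} (hs : MeasurableSet s) (σ u : ℝ) :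
    ∫ p, voteWeight s σ u p ∂π =
      1 + (margX π).real s * (u⁻¹ - 1) + π.real (s ×ˢ {σ}) * (u - u⁻¹) := by
  have h1 : Integrable ((s ×ˢ (univ : Set ℝ)).indicator fun _ => u⁻¹ - 1) π :=
    (integrable_const _).indicator (hs.prod .univ)
  have h2 : Integrable ((s ×ˢ ({σ} : Set ℝ)).indicator fun _ => u - u⁻¹) π :=
    (integrable_const _).indicator (hs.prod (measurableSet_singleton _))
  simp only [voteWeight_eq]
  have h3 : Integrable (fun p => 1 + (s ×ˢ (univ : Set ℝ)).indicator (fun _ => u⁻¹ - 1) p) π :=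
    (integrable_const _).add h1
  rw [integral_add h3 h2, integral_add (integrable_const _) h1,
    integral_indicator_const _ (hs.prod .univ),
    integral_indicator_const _ (hs.prod (measurableSet_singleton _)), margX_real_apply hs]
  simp

theorem integral_voteWeight_le {s : Set (Pt d)} (hs : MeasurableSet s) {σ h : ℝ} (hh : 0 < h)
    (hh1 : h ≤ 1) (hq : (1 + h) / 2 * (margX π).real s ≤ π.real (s ×ˢ {σ})) :
    ∫ p, voteWeight s σ (1 - h / 2) p ∂π ≤ Real.exp (-((margX π).real s * (h ^ 2 / 4))) := by
  have hu : 0 < 1 - h / 2 := by linarith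
  have hP : 0 ≤ (margX π).real s := measureReal_nonneg
  have hinv : (1 - h / 2)⁻¹ ≤ 1 + h / 2 + h ^ 2 / 2 := by
    rw [inv_le_iff_one_le_mul₀ hu]
    nlinarith [mul_nonneg (sq_nonneg h) (sub_nonneg.2 hh1)]
  have hinv1 : 1 ≤ (1 - h / 2)⁻¹ := (one_le_inv₀ hu).2 (by linarith)
  have hkey : (1 - h) / 2 * (1 - h / 2)⁻¹ + (1 + h) / 2 * (1 - h / 2) - 1 ≤ -(h ^ 2 / 4) := by
    have := mul_le_mul_of_nonneg_left hinv (show 0 ≤ (1 - h) / 2 by linarith)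
    have h3 : 0 ≤ h ^ 3 := by positivity
    nlinarith
  rw [integral_voteWeight hs]
  calc _ ≤ 1 + (margX π).real s * ((1 - h / 2)⁻¹ - 1) +
        (1 + h) / 2 * (margX π).real s * ((1 - h / 2) - (1 - h / 2)⁻¹) := by
        have := mul_le_mul_of_nonpos_right hq
          (show (1 - h / 2) - (1 - h / 2)⁻¹ ≤ 0 by linarith)
        linarith
    _ = 1 + (margX π).real s *
        ((1 - h) / 2 * (1 - h / 2)⁻¹ + (1 + h) / 2 * (1 - h / 2) - 1) := by ring
    _ ≤ 1 + (margX π).real s * (-(h ^ 2 / 4)) := by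
        have := mul_le_mul_of_nonneg_left hkey hP
        linarith
    _ ≤ _ := by
        have := Real.add_one_le_exp (-((margX π).real s * (h ^ 2 / 4)))
        linarith

theorem risk_sub_risk_le (f g : Pt d → ℝ) :
    risk π f - risk π g ≤ π.real {p | f p.1 ≠ g p.1} := by
  have : risk π f ≤ π.real ({p | g p.1 ≠ p.2} ∪ {p | f p.1 ≠ g p.1}) := by
    refine measureReal_mono fun p hp => ?_
    by_cases h1 : f p.1 = g p.1
    · exact Or.inl (by rwa [mem_ofPred_eq, ← h1])
    · exact Or.inr h1
  have h2 := this.trans (measureReal_union_le _ _)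
  rw [sub_le_iff_le_add']
  exact h2

/-- The expected excess risk is bounded by the vote error on the cubes of `G`, on which the Bayes
rule is constant, plus the mass outside these cubes. -/
theorem excessExp_fhat_le {η : Pt d → ℝ} {h c : ℝ} (hh : 0 < h) (hh1 : h ≤ 1)
    (hL : Labels π) (hη : IsRegression π η) (hS : SMAcond π η h) {J : ℕ} (n : ℕ)
    (G : Finset (Fin d → ℕ)) (hG : ∀ k ∈ G, ∀ i, k i < 2 ^ J)
    (hconst : ∀ k ∈ G, ∀ x ∈ dyadicCube d J k, ∀ y ∈ dyadicCube d J k, bayes η x = bayes η y)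
    (hP : ∀ k ∈ G, c ≤ (margX π).real (dyadicCube d J k)) :
    excessExp π η n (fhat d J n) ≤ Real.exp (-(n * (c * (h ^ 2 / 4)))) +
      (margX π).real (⋃ k ∈ G, dyadicCube d J k)ᶜ := by
  have hσ : ∀ k, ∃ σ : ℝ, (σ = 1 ∨ σ = -1) ∧
      (k ∈ G → ∀ x ∈ dyadicCube d J k, bayes η x = σ) := by
    intro k
    by_cases hk : k ∈ G
    · rcases (dyadicCube d J k).eq_empty_or_nonempty with he | ⟨y, hy⟩
      · exact ⟨1, Or.inl rfl, fun _ x hx => by simp [he] at hx⟩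
      · refine ⟨bayes η y, ?_, fun _ x hx => hconst k hk x hx y hy⟩
        unfold bayes
        split_ifs <;> simp
    · exact ⟨1, Or.inl rfl, fun h => absurd h hk⟩
  choose σ hσ1 hσ2 using hσ
  have hmeas := measurableSet_dyadicCube d J
  have hU : MeasurableSet (⋃ k ∈ G, dyadicCube d J k) := G.measurableSet_biUnion fun k _ => hmeas k
  have hdisj : (G : Set (Fin d → ℕ)).PairwiseDisjoint (dyadicCube d J) := by
    intro k hk l hl hkl
    refine disjoint_left.2 fun x hx hx' => hkl (funext fun i => ?_)
    rw [← ((mem_dyadicCube_iff (hG k hk) x).1 hx).2 i,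
      ((mem_dyadicCube_iff (hG l hl) x).1 hx').2 i]
  have hu0 : 0 < 1 - h / 2 := by linarith
  set B := (⋃ k ∈ G, dyadicCube d J k)ᶜ with hB
  set W : (Fin d → ℕ) → (Fin n → Pt d × ℝ) → ℝ := fun k t =>
    ∏ i, voteWeight (dyadicCube d J k) (σ k) (1 - h / 2) (t i) with hW
  have hW0 : ∀ k t, 0 ≤ W k t := fun k t => Finset.prod_nonneg fun i _ =>
    voteWeight_nonneg _ _ hu0.le _
  have hWint : ∀ k, Integrable (W k) (sampM π n) := fun k =>
    Integrable.fintype_prod (f := fun _ => voteWeight (dyadicCube d J k) (σ k) (1 - h / 2))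
      (μ := fun _ => π) fun _ => integrable_voteWeight (hmeas k) _ _
  have hpt : ∀ t, risk π (fhat d J n t) ≤ risk π (bayes η) + ((margX π).real B +
      ∑ k ∈ G, W k t * (margX π).real (dyadicCube d J k)) := by
    intro t
    classical
    have hsub : {p : Pt d × ℝ | fhat d J n t p.1 ≠ bayes η p.1} ⊆ (B ×ˢ univ) ∪
        ⋃ k ∈ G.filter fun k => 1 ≤ W k t, dyadicCube d J k ×ˢ univ := by
      intro p hp
      by_cases hpB : p.1 ∈ B
      · exact Or.inl ⟨hpB, mem_univ _⟩
      · rw [hB, notMem_compl_iff, mem_iUnion₂] at hpB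
        obtain ⟨k, hk, hpk⟩ := hpB
        refine Or.inr (mem_iUnion₂.2 ⟨k, Finset.mem_filter.2 ⟨hk, ?_⟩, hpk, mem_univ _⟩)
        rw [mem_ofPred_eq, hσ2 k hk _ hpk] at hp
        have := one_le_prod_voteWeight t (hσ1 k) hu0 (by linarith) hp
        rwa [cubeOf_eq (hG k hk) hpk] at this
    have h1 := (risk_sub_risk_le (π := π) (fhat d J n t) (bayes η)).trans
      ((measureReal_mono hsub).trans (measureReal_union_le _ _))
    have h2 : π.real (⋃ k ∈ G.filter fun k => 1 ≤ W k t, dyadicCube d J k ×ˢ univ) ≤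
        ∑ k ∈ G, W k t * (margX π).real (dyadicCube d J k) := by
      refine (measureReal_biUnion_finset_le _ _).trans ?_
      rw [Finset.sum_filter]
      refine Finset.sum_le_sum fun k _ => ?_
      split_ifs with hk
      · rw [← margX_real_apply (hmeas k)]
        exact le_mul_of_one_le_left measureReal_nonneg hk
      · exact mul_nonneg (hW0 k t) measureReal_nonneg
    rw [← margX_real_apply hU.compl] at h1
    linarith
  have : IsProbabilityMeasure (sampM π n) := by unfold sampM; infer_instance
  have hsumint : Integrable (fun t => ∑ k ∈ G, W k t * (margX π).real (dyadicCube d J k))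
      (sampM π n) := integrable_finsetSum _ fun k _ => (hWint k).mul_const _
  have hsumint' : Integrable (fun t => (margX π).real B +
      ∑ k ∈ G, W k t * (margX π).real (dyadicCube d J k)) (sampM π n) :=
    (integrable_const _).add hsumint
  have hWle : ∀ k ∈ G, ∫ t, W k t ∂sampM π n ≤ Real.exp (-(n * (c * (h ^ 2 / 4)))) := by
    intro k hk
    have e : ∫ t, W k t ∂sampM π n =
        (∫ p, voteWeight (dyadicCube d J k) (σ k) (1 - h / 2) p ∂π) ^ n := by
      have := integral_fintype_prod_eq_prod (𝕜 := ℝ)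
        (fun _ : Fin n => voteWeight (dyadicCube d J k) (σ k) (1 - h / 2)) (μ := fun _ => π)
      simpa [hW, sampM] using this
    rw [e]
    refine (pow_le_pow_left₀ (integral_nonneg fun p => voteWeight_nonneg _ _ hu0.le p)
      (integral_voteWeight_le (hmeas k) hh hh1 (le_measureReal_label hL hη hS (hmeas k)
        (hσ1 k) (hσ2 k hk))) n).trans ?_
    rw [← Real.exp_nat_mul, Real.exp_le_exp, mul_neg, neg_le_neg_iff]
    gcongr
    exact hP k hk
  have hfin : ∫ t, risk π (fhat d J n t) ∂sampM π n ≤ ∫ t, (risk π (bayes η) +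
      ((margX π).real B + ∑ k ∈ G, W k t * (margX π).real (dyadicCube d J k))) ∂sampM π n :=
    integral_mono_of_nonneg (Filter.Eventually.of_forall fun t => ENNReal.toReal_nonneg)
      ((integrable_const _).add hsumint')
      (Filter.Eventually.of_forall hpt)
  rw [integral_add (integrable_const _) hsumint',
    integral_add (integrable_const _) hsumint,
    integral_finsetSum _ fun k _ => (hWint k).mul_const _] at hfin
  simp only [integral_mul_const, integral_const, probReal_univ, one_smul] at hfin
  have hsum : ∑ k ∈ G, (∫ t, W k t ∂sampM π n) * (margX π).real (dyadicCube d J k) ≤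
      Real.exp (-(n * (c * (h ^ 2 / 4)))) := by
    calc _ ≤ ∑ k ∈ G, Real.exp (-(n * (c * (h ^ 2 / 4)))) *
          (margX π).real (dyadicCube d J k) :=
          Finset.sum_le_sum fun k hk => mul_le_mul_of_nonneg_right (hWle k hk) measureReal_nonneg
      _ = Real.exp (-(n * (c * (h ^ 2 / 4)))) *
          (margX π).real (⋃ k ∈ G, dyadicCube d J k) := by
          rw [← Finset.mul_sum, measureReal_biUnion_finset hdisj fun k _ => hmeas k]
      _ ≤ _ := mul_le_of_le_one_right (Real.exp_pos _).le measureReal_le_one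
  unfold excessExp
  linarith

end Voting

/-- A dyadic representation with geometrically controlled numbers of cubes yields, at every level,
a family of cubes on which the Bayes rule is constant and which misses little mass. -/
theorem exists_constant_cubes {d : ℕ} {π : Measure (Pt d × ℝ)} {f : Pt d → ℝ} {a A : ℝ}
    (hA : 0 ≤ A) (hA1 : A1cond π a A) {w : ℕ → ℝ} (hf : memFw d w f) {K r : ℝ} (hK : 0 ≤ K)
    (hr0 : 0 ≤ r) (hr1 : r < 1) (hw : ∀ j, w j * (2 ^ (d * j))⁻¹ ≤ K * r ^ j)
    (hw0 : ∀ j, 0 ≤ w j) (J : ℕ) :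
    ∃ G : Finset (Fin d → ℕ), (∀ k ∈ G, ∀ i, k i < 2 ^ J) ∧
      (∀ k ∈ G, ∀ x ∈ dyadicCube d J k, ∀ y ∈ dyadicCube d J k, f x = f y) ∧
      (margX π).real (⋃ k ∈ G, dyadicCube d J k)ᶜ ≤ A * (K / (1 - r) * r ^ J) := by
  classical
  obtain ⟨-, -, T, ⟨hTk, -, hTcov, hTf⟩, hTw⟩ := hf
  set G : Finset (Fin d → ℕ) := (Fintype.piFinset fun _ => Finset.range (2 ^ J)).filter
    fun k => ∃ p ∈ T, dyadicCube d J k ⊆ dyadicCube d p.1 p.2 with hG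
  have hU : MeasurableSet (⋃ k ∈ G, dyadicCube d J k) :=
    G.measurableSet_biUnion fun k _ => measurableSet_dyadicCube d J k
  have hr : 0 ≤ K / (1 - r) * r ^ J :=
    mul_nonneg (div_nonneg hK (by linarith)) (pow_nonneg hr0 _)
  refine ⟨G, fun k hk i => ?_, fun k hk x hx y hy => ?_, ?_⟩
  · exact Finset.mem_range.1 (Fintype.mem_piFinset.1 (Finset.mem_filter.1 hk).1 i)
  · obtain ⟨p, hp, hsub⟩ := (Finset.mem_filter.1 hk).2
    exact hTf p hp x (hsub hx) y (hsub hy)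
  · have hsub : (⋃ k ∈ G, dyadicCube d J k)ᶜ ⊆
        ((unitCube d)ᶜ ∪ (unitCube d \ ⋃ p ∈ T, dyadicCube d p.1 p.2)) ∪
          ⋃ p ∈ T ∩ {p | J < p.1}, dyadicCube d p.1 p.2 := by
      intro x hx
      by_cases hxc : x ∈ unitCube d
      · by_cases hxT : x ∈ ⋃ p ∈ T, dyadicCube d p.1 p.2
        · right
          obtain ⟨p, hp, hxp⟩ := mem_iUnion₂.1 hxT
          refine mem_iUnion₂.2 ⟨p, ⟨hp, ?_⟩, hxp⟩
          by_contra hcon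
          refine hx (mem_iUnion₂.2 ⟨fun i => dyadicIdx J (x i), Finset.mem_filter.2 ⟨?_, p, hp, ?_⟩,
            mem_cubeOf hxc⟩)
          · exact Fintype.mem_piFinset.2 fun i => Finset.mem_range.2 (dyadicIdx_lt _ _)
          · exact dyadicCube_subset_of_mem (not_lt.1 hcon) (hTk p hp) (fun i => dyadicIdx_lt _ _)
              hxp (mem_cubeOf hxc)
        · exact Or.inl (Or.inr ⟨hxc, hxT⟩)
      · exact Or.inl (Or.inl hxc)
    have hcube : MeasurableSet (unitCube d) := measurableSet_Icc
    have hnull : lamd d ((unitCube d)ᶜ ∪ (unitCube d \ ⋃ p ∈ T, dyadicCube d p.1 p.2)) = 0 := by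
      refine measure_union_null ?_ hTcov
      rw [lamd, Measure.restrict_apply hcube.compl, compl_inter_self, measure_empty]
    have hle : lamd d (⋃ k ∈ G, dyadicCube d J k)ᶜ ≤ ENNReal.ofReal (K / (1 - r) * r ^ J) := by
      refine (measure_mono hsub).trans ((measure_union_le _ _).trans ?_)
      rw [hnull, zero_add]
      exact lamd_iUnion_fine_le w hK hr0 hr1 hTw hw hw0 J
    refine ENNReal.toReal_le_of_le_ofReal (mul_nonneg hA hr) ?_
    rw [ENNReal.ofReal_mul hA]
    exact (hA1 _ hU.compl).2.trans (by gcongr)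

theorem le_measureReal_dyadicCube {d : ℕ} {π : Measure (Pt d × ℝ)} [IsProbabilityMeasure π]
    {a A : ℝ} (ha : 0 ≤ a) (hA1 : A1cond π a A) {J : ℕ} {k : Fin d → ℕ} (hk : ∀ i, k i < 2 ^ J) :
    a * (2 ^ (d * J))⁻¹ ≤ (margX π).real (dyadicCube d J k) := by
  have h1 := (hA1 _ (measurableSet_dyadicCube d J k)).1
  rw [lamd_dyadicCube hk, ← ENNReal.ofReal_mul ha] at h1
  exact (ENNReal.ofReal_le_iff_le_toReal (measure_ne_top _ _)).1 h1

/-- The largest power `b ^ J ≤ c / q` balances the variance and the bias. -/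
theorem exp_add_bias_le {b n : ℕ} (hb : 1 < b) (hn : 3 ≤ n) {c M β : ℝ} (hc : 0 < c) (hM : 0 ≤ M)
    (hβ0 : 0 < β) (hβ1 : β ≤ 1) :
    Real.exp (-(n * (c * ((b : ℝ) ^ Nat.log b ⌊c / (Real.log n / n)⌋₊)⁻¹))) +
        M * (((b : ℝ) ^ Nat.log b ⌊c / (Real.log n / n)⌋₊)⁻¹) ^ β ≤
      (1 + (c⁻¹) ^ β + M * (b / c) ^ β) * (Real.log n / n) ^ β := by
  have hn3 : (3 : ℝ) ≤ n := by exact_mod_cast hn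
  have hn0 : (0 : ℝ) < n := by linarith
  have hlog : 1 ≤ Real.log n := by
    rw [Real.le_log_iff_exp_le hn0]
    exact (Real.exp_one_lt_d9.le.trans (by norm_num)).trans hn3
  set q := Real.log n / n with hq
  set J := Nat.log b ⌊c / q⌋₊ with hJ
  have hq0 : 0 < q := by positivity
  have hq1 : q ≤ 1 := by
    rw [hq, div_le_one hn0]
    linarith [Real.log_le_sub_one_of_pos hn0]
  have hb0 : (0 : ℝ) < b := by exact_mod_cast (by omega : 0 < b)
  have hbJ : (0 : ℝ) < (b : ℝ) ^ J := by positivity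
  have hbias : ((b : ℝ) ^ J)⁻¹ ≤ b / c * q := by
    have h1 : c / q < (b : ℝ) ^ (J + 1) := by
      have h2 := Nat.lt_pow_succ_log_self hb ⌊c / q⌋₊
      refine (Nat.lt_floor_add_one (c / q)).trans_le ?_
      exact_mod_cast h2
    rw [inv_le_iff_one_le_mul₀ hbJ]
    rw [pow_succ, div_lt_iff₀ hq0] at h1
    rw [div_mul_eq_mul_div, div_mul_eq_mul_div, one_le_div hc]
    nlinarith
  have hB : M * (((b : ℝ) ^ J)⁻¹) ^ β ≤ M * (b / c) ^ β * q ^ β := by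
    rw [mul_assoc, ← Real.mul_rpow (by positivity) hq0.le]
    gcongr
  have hV : Real.exp (-(n * (c * ((b : ℝ) ^ J)⁻¹))) ≤ (1 + (c⁻¹) ^ β) * q ^ β := by
    have hqβ : 0 ≤ q ^ β := by positivity
    have hcβ : 0 ≤ (c⁻¹) ^ β := by positivity
    by_cases hcq : 1 ≤ c / q
    · have h1 : (b : ℝ) ^ J ≤ c / q := by
        have h2 := Nat.pow_log_le_self b (Nat.floor_pos.2 hcq).ne'
        refine le_trans ?_ (Nat.floor_le (by positivity))
        exact_mod_cast h2
      have h3 : q ≤ c * ((b : ℝ) ^ J)⁻¹ := by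
        rw [← div_eq_mul_inv, le_div_iff₀ hbJ]
        rw [le_div_iff₀ hq0] at h1
        linarith
      have h4 : Real.log n ≤ n * (c * ((b : ℝ) ^ J)⁻¹) := by
        calc Real.log n = n * q := by rw [hq]; field_simp
          _ ≤ _ := by gcongr
      calc _ ≤ Real.exp (-Real.log n) := Real.exp_le_exp.2 (neg_le_neg h4)
        _ = 1 / n := by rw [Real.exp_neg, Real.exp_log hn0, one_div]
        _ ≤ q := by rw [hq]; gcongr
        _ ≤ q ^ β := Real.self_le_rpow_of_le_one hq0.le hq1 hβ1
        _ ≤ _ := by nlinarith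
    · have h1 : 1 ≤ c⁻¹ * q := by
        rw [not_le, div_lt_one hq0] at hcq
        rw [← div_eq_inv_mul, one_le_div hc]
        exact hcq.le
      calc _ ≤ (1 : ℝ) := Real.exp_le_one_iff.2 (by rw [neg_nonpos]; positivity)
        _ ≤ (c⁻¹ * q) ^ β := Real.one_le_rpow h1 hβ0.le
        _ = (c⁻¹) ^ β * q ^ β := Real.mul_rpow (by positivity) hq0.le
        _ ≤ _ := by nlinarith
  linarith

/-- **Rate for the exponential class, upper bound.** On
`P_α^(d) = P_{w_α,h,a,A}` the dyadic majority-vote classifier at suitable levels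
`J_n` attains the rate `((log n)/n)^{1-α}`. -/
theorem exponential_class_upper_bound (d : ℕ) (hd : 1 ≤ d) (α : ℝ)
    (hα0 : 0 < α) (hα1 : α < 1)
    (h a A : ℝ) (hh : 0 < h) (hh1 : h ≤ 1) (ha : 0 < a) (ha1 : a ≤ 1) (hA : 1 ≤ A) :
    ∃ C : ℝ, 0 < C ∧ ∃ Jn : ℕ → ℕ, ∀ n : ℕ, 3 ≤ n →
      ∀ p : ProbabilityMeasure (Pt d × ℝ) × (Pt d → ℝ),
        p ∈ Pclass d
            (fun j => if j ≤ ⌈Real.log ((2 : ℝ) ^ d - 1) / (d * α * Real.log 2)⌉₊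
              then (2 : ℝ) ^ (d * j) else (2 : ℝ) ^ ((d : ℝ) * α * (j : ℝ))) h a A →
          excessExp (p.1 : Measure (Pt d × ℝ)) p.2 n (fhat d (Jn n) n) ≤
            C * (Real.log n / n) ^ (1 - α) := by
  set w : ℕ → ℝ := fun j => if j ≤ ⌈Real.log ((2 : ℝ) ^ d - 1) / (d * α * Real.log 2)⌉₊
    then (2 : ℝ) ^ (d * j) else (2 : ℝ) ^ ((d : ℝ) * α * (j : ℝ)) with hw
  set N := ⌈Real.log ((2 : ℝ) ^ d - 1) / (d * α * Real.log 2)⌉₊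
  set r : ℝ := 2 ^ (-(d * (1 - α)) : ℝ) with hr
  have hd0 : (0 : ℝ) < d := by exact_mod_cast hd
  have hr0 : 0 < r := by positivity
  have hr1 : r < 1 := Real.rpow_lt_one_of_one_lt_of_neg one_lt_two (by nlinarith)
  have hw0 : ∀ j, 0 ≤ w j := fun j => by simp only [hw]; split_ifs <;> positivity
  have hrpow : ∀ j : ℕ, r ^ j = (((2 ^ d : ℕ) : ℝ) ^ j)⁻¹ ^ (1 - α) := fun j => by
    rw [hr, ← Real.rpow_natCast, ← Real.rpow_mul two_pos.le]
    push_cast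
    rw [← pow_mul, ← Real.rpow_natCast 2 (d * j), ← Real.rpow_neg two_pos.le,
      ← Real.rpow_mul two_pos.le]
    push_cast
    ring_nf
  have hwr : ∀ j, w j * (2 ^ (d * j))⁻¹ ≤ (r ^ N)⁻¹ * r ^ j := fun j => by
    simp only [hw]
    split_ifs with hj
    · rw [mul_inv_cancel₀ (by positivity), ← div_eq_inv_mul, one_le_div (by positivity)]
      exact pow_le_pow_of_le_one hr0.le hr1.le hj
    · have e : (2 : ℝ) ^ ((d : ℝ) * α * j) * (2 ^ (d * j))⁻¹ = r ^ j := by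
        rw [hr, ← Real.rpow_natCast, ← Real.rpow_natCast, ← Real.rpow_mul two_pos.le,
          ← Real.rpow_neg two_pos.le, ← Real.rpow_add two_pos]
        push_cast
        ring_nf
      rw [e]
      exact le_mul_of_one_le_left (by positivity)
        ((one_le_inv₀ (by positivity)).2 (pow_le_one₀ hr0.le hr1.le))
  set c := a * (h ^ 2 / 4) with hc
  have hc0 : 0 < c := by positivity
  set M := A * ((r ^ N)⁻¹ / (1 - r)) with hM
  have hM0 : 0 ≤ M := mul_nonneg (by linarith) (div_nonneg (by positivity) (by linarith))
  refine ⟨1 + (c⁻¹) ^ (1 - α) + M * ((2 ^ d : ℕ) / c) ^ (1 - α), by positivity,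
    fun n => Nat.log (2 ^ d) ⌊c / (Real.log n / n)⌋₊, ?_⟩
  rintro n hn ⟨π, η⟩ ⟨hL, hη, hA1, hS, hf⟩
  dsimp only at hL hη hA1 hS hf ⊢
  refine le_trans ?_ (exp_add_bias_le (Nat.one_lt_two_pow (by omega)) hn hc0 hM0
    (by linarith) (by linarith))
  generalize Nat.log (2 ^ d) ⌊c / (Real.log n / n)⌋₊ = J
  obtain ⟨G, hG, hconst, hB⟩ := exists_constant_cubes (by linarith) hA1 hf
    (inv_nonneg.2 (pow_nonneg hr0.le N)) hr0.le hr1 hwr hw0 J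
  refine (excessExp_fhat_le hh hh1 hL hη hS n G hG hconst
    fun k hk => le_measureReal_dyadicCube ha.le hA1 (hG k hk)).trans ?_
  rw [← hrpow, hM]
  push_cast
  rw [← pow_mul]
  refine add_le_add (le_of_eq ?_) (hB.trans_eq (by ring))
  rw [hc]
  ring_nf
end
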